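/- Let H be the family of halfspace classifiers of ℝ^d, let p ≥ 1 and ε > 0, let B = {z ∈ ℝ^d : ‖z‖_p ≤ ε} be the closed ℓ_p ball of radius ε, and let R = {(x,y) : ‖y − x‖_p ≤ ε}. Then AVC(H,R) = d + 1; that is, the adversarial VC dimension of halfspace classifiers under a bounded ℓ_p-norm adversary equals the standard VC dimension d + 1 of halfspace classifiers. -/

import Mathlib

open scoped RealInnerProductSpace ENNReal

attribute [local instance] Classical.propDecidable

/-- The sign function with values in `{-1, 1, ⊥}`, encoded in `Option ℤ`:
`sgn t = some 1` for `t > 0`, `some (-1)` for `t < 0`, and `none` (i.e. `⊥`) for `t = 0`. -/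
noncomputable def sgn' (t : ℝ) : Option ℤ :=
  if 0 < t then some 1 else if t < 0 then some (-1) else none

/-- The halfspace classifier on `ℝ^d` determined by `(a, b)`: `x ↦ sgn(aᵀx − b)`. -/
noncomputable def halfspace {d : ℕ} (a : EuclideanSpace ℝ (Fin d)) (b : ℝ) :
    EuclideanSpace ℝ (Fin d) → Option ℤ :=
  fun x => sgn' (⟪a, x⟫ - b)

/-- The corrupted hypothesis `κ_R(h)` for the constraint `R = {(x,y) : y − x ∈ B}`
(so `N(x) = x + B`): it maps `x` to `some c` (for `c ∈ {-1,1}`) if `h y = some c` for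
all `y ∈ N(x)`, and to `none` (i.e. `⊥`) otherwise. -/
noncomputable def corruptB {d : ℕ} (B : Set (EuclideanSpace ℝ (Fin d)))
    (h : EuclideanSpace ℝ (Fin d) → Option ℤ) (x : EuclideanSpace ℝ (Fin d)) : Option ℤ :=
  if ∀ y, y - x ∈ B → h y = some 1 then some 1
  else if ∀ y, y - x ∈ B → h y = some (-1) then some (-1)
  else none

/-- The corrupted loss class of the halfspace classifiers,
`{(y,c) ↦ 1(κ_R(h)(y) ≠ c) : h halfspace}` with `1(⊥ ≠ c) = 1`, achieves all `2^n` loss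
patterns on some `n`-tuple of labeled points in `ℝ^d × {-1,1}`. -/
def halfspaceCorruptShatters (d : ℕ) (B : Set (EuclideanSpace ℝ (Fin d))) (n : ℕ) : Prop :=
  ∃ (x : Fin n → EuclideanSpace ℝ (Fin d)) (c : Fin n → ℤ),
    (∀ j : Fin n, c j = -1 ∨ c j = 1) ∧
    ∀ η : Fin n → Bool, ∃ (a : EuclideanSpace ℝ (Fin d)) (b : ℝ),
      ∀ j : Fin n, (corruptB B (halfspace a b) (x j) ≠ some (c j)) ↔ η j = true

theorem sgn'_eq_some_one_iff (t : ℝ) : sgn' t = some 1 ↔ 0 < t := by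
  unfold sgn'
  split_ifs <;> simp_all

theorem sgn'_eq_some_neg_one_iff (t : ℝ) : sgn' t = some (-1) ↔ t < 0 := by
  unfold sgn'
  split_ifs with h₁ h₂
  · simpa using h₁.le
  · simpa using h₂
  · simpa using h₂

/-- The corrupted halfspace classifies `x` as `c` iff every admissible perturbation of `x` lies
strictly on the side `c` of the hyperplane. -/
theorem corruptB_halfspace_eq_some_iff {d : ℕ} {B : Set (EuclideanSpace ℝ (Fin d))}
    (hB : (0 : EuclideanSpace ℝ (Fin d)) ∈ B) (a : EuclideanSpace ℝ (Fin d)) (b : ℝ)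
    (x : EuclideanSpace ℝ (Fin d)) {c : ℤ} (hc : c = -1 ∨ c = 1) :
    corruptB B (halfspace a b) x = some c ↔
      ∀ z ∈ B, 0 < (c : ℝ) * (⟪a, x⟫ - b) + c * ⟪a, z⟫ := by
  have key : (∀ y, y - x ∈ B → halfspace a b y = some c) ↔
      ∀ z ∈ B, 0 < (c : ℝ) * (⟪a, x⟫ - b) + c * ⟪a, z⟫ := by
    have hsgn (y : EuclideanSpace ℝ (Fin d)) :
        halfspace a b y = some c ↔ 0 < (c : ℝ) * (⟪a, y⟫ - b) := by
      rcases hc with rfl | rfl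
      · simp only [halfspace, sgn'_eq_some_neg_one_iff]
        push_cast
        constructor <;> intro h <;> linarith
      · simp [halfspace, sgn'_eq_some_one_iff]
    simp only [hsgn]
    constructor
    · intro h z hz
      have := h (x + z) (by simpa using hz)
      rw [inner_add_right] at this
      linarith
    · intro h y hy
      have := h (y - x) hy
      rw [inner_sub_right] at this
      linarith
  rw [← key]
  have hx : x - x ∈ B := by simpa using hB
  unfold corruptB
  rcases hc with rfl | rfl
  · split_ifs with h₁ h₂
    · have h₃ := h₁ x hx
      refine iff_of_false (by simp) fun h => ?_
      have h₄ := h x hx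
      rw [h₃] at h₄
      simp at h₄
    · simpa using h₂
    · simpa using h₂
  · split_ifs with h₁ h₂
    · simpa using h₁
    · simpa using h₁
    · simpa using h₁

/-- No more than `d + 1` points are shattered, for any compact symmetric set of perturbations
containing the origin. -/
theorem le_of_halfspaceCorruptShatters {d n : ℕ} {B : Set (EuclideanSpace ℝ (Fin d))}
    (hB : (0 : EuclideanSpace ℝ (Fin d)) ∈ B) (hcomp : IsCompact B) (hneg : ∀ z ∈ B, -z ∈ B)
    (h : halfspaceCorruptShatters d B n) : n ≤ d + 1 := by
  obtain ⟨x, c, hc, h⟩ := h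
  by_contra! hn
  let w : Fin n → EuclideanSpace ℝ (Fin d) × ℝ := fun j => (c j : ℝ) • (x j, 1)
  have hdep : ¬ LinearIndependent ℝ w := fun hw => by
    have := hw.fintype_card_le_finrank
    simp at this
    omega
  obtain ⟨l, hl, hl₀, hlpos⟩ :
      ∃ l : Fin n → ℝ, ∑ j, l j • w j = 0 ∧ (∃ j, l j ≠ 0) ∧ 0 ≤ ∑ j, l j := by
    obtain ⟨l, hl, i, hi⟩ := Fintype.not_linearIndependent_iff.mp hdep
    rcases le_total 0 (∑ j, l j) with hs | hs
    · exact ⟨l, hl, ⟨i, hi⟩, hs⟩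
    · exact ⟨-l, by simpa using hl, ⟨i, by simpa using hi⟩, by simpa using hs⟩
  obtain ⟨i, hi⟩ : ∃ i, 0 < l i := by
    by_contra! hle
    obtain ⟨j, hj⟩ := hl₀
    have : ∑ j, l j < 0 :=
      Finset.sum_neg' (fun j _ => hle j) ⟨j, Finset.mem_univ j, lt_of_le_of_ne (hle j) hj⟩
    linarith
  obtain ⟨a, b, hab⟩ := h fun j => decide (l j ≤ 0)
  obtain ⟨z₀, hz₀, hmax⟩ := hcomp.exists_isMaxOn ⟨0, hB⟩
    (f := fun z => ⟪a, z⟫) (by fun_prop)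
  have hmax' : ∀ z ∈ B, ⟪a, z⟫ ≤ ⟪a, z₀⟫ := hmax
  set g : ℝ := ⟪a, z₀⟫
  have hg : 0 ≤ g := by simpa using hmax' 0 hB
  set u : Fin n → ℝ := fun j => (c j : ℝ) * (⟪a, x j⟫ - b) with hu
  have hiff (j : Fin n) : corruptB B (halfspace a b) (x j) = some (c j) ↔ g < u j := by
    rw [corruptB_halfspace_eq_some_iff hB a b (x j) (hc j)]
    have h₂ := hneg z₀ hz₀
    constructor
    · intro h
      have e₁ := h z₀ hz₀
      have e₂ := h (-z₀) h₂
      rw [inner_neg_right] at e₂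
      simp only [hu]
      rcases hc j with hcj | hcj <;> rw [hcj] at e₁ e₂ ⊢ <;> push_cast at e₁ e₂ ⊢ <;> linarith
    · intro h z hz
      have e₁ := hmax' z hz
      have e₂ := hmax' (-z) (hneg z hz)
      rw [inner_neg_right] at e₂
      simp only [hu] at h
      rcases hc j with hcj | hcj <;> rw [hcj] at h ⊢ <;> push_cast at h ⊢ <;> linarith
  have hpat (j : Fin n) : g < u j ↔ 0 < l j := by
    have := hab j
    rw [ne_eq, hiff, decide_eq_true_eq] at this
    rw [← not_le (a := l j), ← this, not_not]
  have hsum : ∑ j, l j * u j = 0 := by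
    have h₁ : ∑ j, l j * (c j : ℝ) * ⟪a, x j⟫ = 0 := by
      have := congrArg (fun q : EuclideanSpace ℝ (Fin d) × ℝ => ⟪a, q.1⟫) hl
      simpa [w, Prod.fst_sum, inner_sum, inner_smul_right, mul_assoc] using this
    have h₂ : ∑ j, l j * (c j : ℝ) = 0 := by
      have := congrArg Prod.snd hl
      simpa [w, Prod.snd_sum] using this
    calc ∑ j, l j * u j = ∑ j, l j * (c j : ℝ) * ⟪a, x j⟫ - (∑ j, l j * (c j : ℝ)) * b := by
          rw [Finset.sum_mul, ← Finset.sum_sub_distrib]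
          exact Finset.sum_congr rfl fun j _ => by simp only [hu]; ring
      _ = 0 := by rw [h₁, h₂]; ring
  have hlt : ∑ j, l j * g < ∑ j, l j * u j := by
    refine Finset.sum_lt_sum (fun j _ => ?_) ⟨i, Finset.mem_univ i, ?_⟩
    · by_cases hj : 0 < l j
      · exact mul_le_mul_of_nonneg_left ((hpat j).mpr hj).le hj.le
      · exact mul_le_mul_of_nonpos_left (not_lt.mp (mt (hpat j).mp hj)) (not_lt.mp hj)
    · exact mul_lt_mul_of_pos_left ((hpat i).mpr hi) hi
  rw [hsum, ← Finset.sum_mul] at hlt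
  exact absurd hlt (not_lt.mpr (mul_nonneg hlpos hg))

/-- The origin and far away multiples of the basis vectors are shattered, for any coordinatewise
bounded set of perturbations containing the origin. -/
theorem halfspaceCorruptShatters_succ {d : ℕ} {B : Set (EuclideanSpace ℝ (Fin d))} {ε : ℝ}
    (hε : 0 ≤ ε) (hB : (0 : EuclideanSpace ℝ (Fin d)) ∈ B) (hbdd : ∀ z ∈ B, ∀ i, |z i| ≤ ε) :
    halfspaceCorruptShatters d B (d + 1) := by
  set t : ℝ := d * ε + 1 with ht_def
  have ht : 0 < t := by positivity
  refine ⟨Fin.cons 0 fun i => EuclideanSpace.single i t, fun _ => 1, fun _ => Or.inr rfl,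
    fun η => ?_⟩
  let v : Fin (d + 1) → ℝ := fun j => if η j then 0 else 1
  have hv (i j) : |v i - v j| ≤ 1 := by
    simp only [v]
    split_ifs <;> simp
  let a : EuclideanSpace ℝ (Fin d) := WithLp.toLp 2 fun i => (v i.succ - v 0) / t
  have hval (j : Fin (d + 1)) : ⟪a, (Fin.cons 0 fun i => EuclideanSpace.single i t :
      Fin (d + 1) → EuclideanSpace ℝ (Fin d)) j⟫ - -v 0 = v j := by
    refine Fin.cases ?_ (fun i => ?_) j
    · simp
    · simp [a, EuclideanSpace.inner_single_right]
      field_simp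
      ring
  have hsmall : ∀ z ∈ B, |⟪a, z⟫| < 1 := by
    intro z hz
    have hterm (i : Fin d) : |z i * a i| ≤ ε / t := by
      rw [abs_mul, div_eq_mul_one_div]
      refine mul_le_mul (hbdd z hz i) ?_ (abs_nonneg _) hε
      simp only [a, abs_div, abs_of_pos ht]
      gcongr
      exact hv _ _
    calc |⟪a, z⟫| = |∑ i, z i * a i| := by simp [PiLp.inner_apply]
      _ ≤ ∑ i : Fin d, |z i * a i| := Finset.abs_sum_le_sum_abs _ _
      _ ≤ ∑ _i : Fin d, ε / t := Finset.sum_le_sum fun i _ => hterm i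
      _ = d * ε / t := by simp [mul_div_assoc]
      _ < 1 := by rw [div_lt_one ht]; linarith
  refine ⟨a, -v 0, fun j => ?_⟩
  rw [ne_eq, corruptB_halfspace_eq_some_iff hB a _ _ (Or.inr rfl), hval]
  by_cases hj : η j = true
  · refine iff_of_true (fun h => ?_) hj
    simpa [v, hj] using h 0 hB
  · refine iff_of_false (not_not.mpr fun z hz => ?_) hj
    have := (abs_lt.mp (hsmall z hz)).1
    simp only [v, hj]
    simp
    linarith

theorem abs_apply_le_of_sum_rpow_le {ι : Type*} [Fintype ι] {p ε : ℝ} (hp : 0 < p)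
    {z : ι → ℝ} (hz : (∑ i, |z i| ^ p) ^ (1 / p) ≤ ε) (i : ι) : |z i| ≤ ε := by
  have h : |z i| ^ p ≤ ∑ i, |z i| ^ p :=
    Finset.single_le_sum (f := fun i => |z i| ^ p) (fun j _ => by positivity) (Finset.mem_univ i)
  calc |z i| = (|z i| ^ p) ^ (1 / p) := by
        rw [← Real.rpow_mul (abs_nonneg _), mul_one_div_cancel hp.ne', Real.rpow_one]
    _ ≤ (∑ i, |z i| ^ p) ^ (1 / p) := by gcongr
    _ ≤ ε := hz

theorem isCompact_setOf_sum_rpow_le {ι : Type*} [Fintype ι] {p ε : ℝ} (hp : 0 < p) :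
    IsCompact {z : EuclideanSpace ℝ ι | (∑ i, |z i| ^ p) ^ (1 / p) ≤ ε} := by
  have hcont : Continuous fun z : EuclideanSpace ℝ ι => (∑ i, |z i| ^ p) ^ (1 / p) := by
    refine Continuous.rpow_const (continuous_finsetSum _ fun i _ => ?_)
      fun _ => Or.inr (by positivity)
    exact Continuous.rpow_const (by fun_prop) fun _ => Or.inr hp.le
  refine Metric.isCompact_of_isClosed_isBounded (isClosed_le hcont continuous_const) ?_
  refine isBounded_iff_forall_norm_le.mpr ⟨√(∑ _i : ι, ε ^ 2), fun z hz => ?_⟩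
  rw [EuclideanSpace.norm_eq]
  gcongr with i
  exact abs_apply_le_of_sum_rpow_le hp hz i

/-- **Adversarial VC-dimension of halfspace classifiers under a bounded `ℓ_p` adversary.**
For the family of halfspace classifiers of `ℝ^d`, `p ≥ 1`, `ε > 0`, the closed `ℓ_p`
ball `B = {z : ‖z‖_p ≤ ε}` and `R = {(x,y) : ‖y − x‖_p ≤ ε}`, the adversarial
VC-dimension equals `d + 1`, the standard VC-dimension of halfspace classifiers. -/
theorem adversarial_vc_dimension_halfspaces_lp
    (d : ℕ) (p ε : ℝ) (hp : 1 ≤ p) (hε : 0 < ε) :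
    (⨆ (n : ℕ)
        (_ : halfspaceCorruptShatters d
          {z : EuclideanSpace ℝ (Fin d) | (∑ i : Fin d, |z i| ^ p) ^ (1 / p) ≤ ε} n),
      (n : ℕ∞)) = ((d + 1 : ℕ) : ℕ∞) := by
  have hp₀ : 0 < p := by linarith
  have hB : (0 : EuclideanSpace ℝ (Fin d)) ∈
      {z : EuclideanSpace ℝ (Fin d) | (∑ i : Fin d, |z i| ^ p) ^ (1 / p) ≤ ε} := by
    simp [Real.zero_rpow hp₀.ne', Real.zero_rpow (inv_ne_zero hp₀.ne'), hε.le]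
  refine le_antisymm (iSup₂_le fun n hn => ?_) (le_iSup₂_of_le (d + 1) ?_ le_rfl)
  · exact_mod_cast le_of_halfspaceCorruptShatters hB (isCompact_setOf_sum_rpow_le hp₀)
      (fun z hz => by simpa using hz) hn
  · exact halfspaceCorruptShatters_succ hε.le hB
      fun z hz i => abs_apply_le_of_sum_rpow_le hp₀ hz i
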